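/- For every positive integer q and every natural number n ≥ 1, T(n, {q}) ≥ ∏_{m=0}^{q−1} T( ⌊(n−m)/q⌋, {1} ). -/

import Mathlib

/-- Two permutations of `[n]` are `G(D)`-different if at some position the
absolute difference of their values lies in `D`. `T n D` is the maximum
cardinality of a set of pairwise `G(D)`-different permutations of `[n]`.
Note that `T 0 D = 1` with this definition. -/
noncomputable def T (n : ℕ) (D : Set ℕ) : ℕ :=
  sSup {k | ∃ S : Finset (Equiv.Perm (Fin n)), S.card = k ∧
    ∀ π ∈ S, ∀ σ ∈ S, π ≠ σ →
      ∃ i : Fin n, ((π i : ℤ) - (σ i : ℤ)).natAbs ∈ D}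

/-- The sizes of sets of pairwise `G(D)`-different permutations of `[n]` are bounded. -/
lemma bddAbove_card_pairwise_different (n : ℕ) (D : Set ℕ) :
    BddAbove {k | ∃ S : Finset (Equiv.Perm (Fin n)), S.card = k ∧
      ∀ π ∈ S, ∀ σ ∈ S, π ≠ σ →
        ∃ i : Fin n, ((π i : ℤ) - (σ i : ℤ)).natAbs ∈ D} := by
  refine ⟨Fintype.card (Equiv.Perm (Fin n)), ?_⟩
  rintro _ ⟨S, rfl, -⟩
  exact S.card_le_univ

/-- The maximum in the definition of `T n D` is attained. -/
lemma exists_card_eq_T (n : ℕ) (D : Set ℕ) :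
    ∃ S : Finset (Equiv.Perm (Fin n)), S.card = T n D ∧
      ∀ π ∈ S, ∀ σ ∈ S, π ≠ σ →
        ∃ i : Fin n, ((π i : ℤ) - (σ i : ℤ)).natAbs ∈ D :=
  Nat.sSup_mem (s := {k | ∃ S : Finset (Equiv.Perm (Fin n)), S.card = k ∧
    ∀ π ∈ S, ∀ σ ∈ S, π ≠ σ →
      ∃ i : Fin n, ((π i : ℤ) - (σ i : ℤ)).natAbs ∈ D}) ⟨0, ∅, by simp⟩
    (bddAbove_card_pairwise_different n D)

/-- The embedding `(m, j) ↦ m + q * j`, whose fibres over `m` lie in the residue classes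
modulo `q`. -/
def residueEmbedding (q n : ℕ) : (Σ m : Fin q, Fin ((n - m) / q)) ↪ Fin n where
  toFun x := ⟨x.1 + q * x.2, by
    obtain ⟨⟨m, hm⟩, ⟨j, hj⟩⟩ := x
    have h : q * (j + 1) ≤ n - m :=
      (Nat.mul_le_mul_left q hj).trans (Nat.mul_div_le _ _)
    rw [Nat.mul_add] at h
    dsimp only
    omega⟩
  inj' := by
    rintro ⟨⟨m, hm⟩, ⟨j, hj⟩⟩ ⟨⟨m', hm'⟩, ⟨j', hj'⟩⟩ h
    have h : m + q * j = m' + q * j' := congrArg Fin.val h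
    have hmm : m = m' := by
      have := congrArg (· % q) h
      simpa [Nat.mod_eq_of_lt hm, Nat.mod_eq_of_lt hm'] using this
    subst hmm
    have hjj : j = j' := Nat.eq_of_mul_eq_mul_left (by omega : 0 < q) (by omega)
    subst hjj
    rfl

/-- For every `q ≥ 1` and `n ≥ 1`,
`T(n, {q}) ≥ ∏_{m=0}^{q-1} T(⌊(n-m)/q⌋, {1})`. -/
theorem T_singleton_ge_prod (q n : ℕ) (hq : 1 ≤ q) (hn : 1 ≤ n) :
    ∏ m ∈ Finset.range q, T ((n - m) / q) {1} ≤ T n {q} := by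
  classical
  choose S hcard hS using fun m : Fin q => exists_card_eq_T ((n - m) / q) {1}
  let f : (∀ m : Fin q, Equiv.Perm (Fin ((n - m) / q))) → Equiv.Perm (Fin n) :=
    fun p => (Equiv.Perm.sigmaCongrRight p).viaEmbedding (residueEmbedding q n)
  have hf : Function.Injective f :=
    (Equiv.Perm.viaEmbeddingHom_injective (residueEmbedding q n)).comp
      Equiv.Perm.sigmaCongrRightHom_injective
  refine le_csSup (bddAbove_card_pairwise_different n {q})
    ⟨(Fintype.piFinset S).image f, ?_, ?_⟩
  · rw [Finset.card_image_of_injective _ hf, Fintype.card_piFinset, Finset.prod_range]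
    exact Finset.prod_congr rfl fun m _ => hcard m
  · simp only [Finset.mem_image, Fintype.mem_piFinset]
    rintro _ ⟨p, hp, rfl⟩ _ ⟨p', hp', rfl⟩ hne
    obtain ⟨m, hm⟩ := Function.ne_iff.mp (ne_of_apply_ne f hne)
    obtain ⟨j, hj⟩ := hS m _ (hp m) _ (hp' m) hm
    refine ⟨residueEmbedding q n ⟨m, j⟩, ?_⟩
    have key (r : ∀ m : Fin q, Equiv.Perm (Fin ((n - m) / q))) :
        ((f r (residueEmbedding q n ⟨m, j⟩) : ℕ) : ℤ) = m + q * (r m j : ℕ) := by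
      simp only [f, Equiv.Perm.viaEmbedding_apply]
      exact Nat.cast_add _ _ |>.trans (congrArg _ (Nat.cast_mul _ _))
    rw [Set.mem_singleton_iff] at hj ⊢
    rw [key, key, add_sub_add_left_eq_sub, ← mul_sub, Int.natAbs_mul, hj]
    simp
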